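/- arXiv:2110.10678 — 2 statements merged into one kernel-verified Lean document; each statement's English description precedes it below -/
import Mathlib

section
/- (Redundancy of formation tracking under partial loss of global positioning.) Let L ∈ ℝ^{N×N} be the weighted Laplacian of symmetric nonnegative weights whose associated graph is connected, let D ∈ ℝ^{N×N} be diagonal with nonnegative entries at least one of which is strictly positive, and let κ_f > 0. Let ξ : ℝ → ℝ^{Nn} be continuous with ξ(t) → 0 as t → ∞, and let x̃ : ℝ → ℝ^{Nn} be differentiable with x̃'(t) = −[(D + κ_f L) ⊗ I_n] x̃(t) + ξ(t) for all t ≥ 0. Then x̃(t) → 0 as t → ∞. -/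
open Matrix BigOperators Filter Kronecker

/-- A real positive definite matrix is bounded below by a positive multiple of the identity. -/
theorem Matrix.PosDef.exists_pos_mul_dotProduct_self_le {ι : Type*} [Fintype ι]
    {A : Matrix ι ι ℝ} (hA : A.PosDef) :
    ∃ c : ℝ, 0 < c ∧ ∀ x : ι → ℝ, c * (x ⬝ᵥ x) ≤ x ⬝ᵥ A *ᵥ x := by
  set S : Set (ι → ℝ) := {x | x ⬝ᵥ x = 1} with hS
  have hcont : Continuous fun x : ι → ℝ => x ⬝ᵥ A *ᵥ x := by fun_prop
  have hcompact : IsCompact S := by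
    refine Metric.isCompact_of_isClosed_isBounded
      (isClosed_eq (by fun_prop) continuous_const) ?_
    refine (Metric.isBounded_closedBall (x := (0 : ι → ℝ)) (r := 1)).subset fun x hx => ?_
    rw [mem_closedBall_zero_iff, pi_norm_le_iff_of_nonneg zero_le_one]
    intro i
    have h : x i * x i ≤ x ⬝ᵥ x :=
      Finset.single_le_sum (f := fun j => x j * x j) (fun j _ => mul_self_nonneg (x j))
        (Finset.mem_univ i)
    rw [hS, Set.mem_ofPred_eq] at hx
    rw [Real.norm_eq_abs, abs_le_one_iff_mul_self_le_one]
    linarith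
  have normalize : ∀ x : ι → ℝ, x ≠ 0 → 0 < x ⬝ᵥ x ∧ (√(x ⬝ᵥ x))⁻¹ • x ∈ S := by
    intro x hx
    have hpos : 0 < x ⬝ᵥ x := by simpa using dotProduct_star_self_pos_iff.mpr hx
    refine ⟨hpos, ?_⟩
    rw [hS, Set.mem_ofPred_eq, smul_dotProduct, dotProduct_smul, smul_eq_mul, smul_eq_mul,
      ← mul_assoc, ← mul_inv, Real.mul_self_sqrt hpos.le, inv_mul_cancel₀ hpos.ne']
  rcases S.eq_empty_or_nonempty with hempty | hne
  · refine ⟨1, one_pos, fun x => ?_⟩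
    have hx : x = 0 := by
      by_contra hx
      simpa [hempty] using (normalize x hx).2
    simp [hx]
  · obtain ⟨y, hyS, hy⟩ := hcompact.exists_isMinOn hne hcont.continuousOn
    have hy0 : y ≠ 0 := by
      rintro rfl
      simp [hS] at hyS
    refine ⟨y ⬝ᵥ A *ᵥ y, by simpa using hA.dotProduct_mulVec_pos hy0, fun x => ?_⟩
    rcases eq_or_ne x 0 with rfl | hx
    · simp
    obtain ⟨hpos, hmem⟩ := normalize x hx
    have h : y ⬝ᵥ A *ᵥ y ≤ (√(x ⬝ᵥ x))⁻¹ • x ⬝ᵥ A *ᵥ ((√(x ⬝ᵥ x))⁻¹ • x) := hy hmem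
    rwa [smul_dotProduct, mulVec_smul, dotProduct_smul, smul_eq_mul, smul_eq_mul,
      ← mul_assoc, ← mul_inv, Real.mul_self_sqrt hpos.le, inv_mul_eq_div, le_div_iff₀ hpos] at h

/-- A nonnegative function with `V' ≤ -c V + g`, where `c > 0` and `g → 0`, tends to zero. -/
theorem tendsto_zero_of_hasDerivAt_le_neg_mul_add {V V' g : ℝ → ℝ} {a c : ℝ} (hc : 0 < c)
    (hV : ∀ t, 0 ≤ V t) (hd : ∀ t, a ≤ t → HasDerivAt V (V' t) t)
    (hle : ∀ t, a ≤ t → V' t ≤ -c * V t + g t) (hg : Tendsto g atTop (nhds 0)) :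
    Tendsto V atTop (nhds 0) := by
  refine tendsto_order.2 ⟨fun b hb => Eventually.of_forall fun t => hb.trans_le (hV t),
    fun ε hε => ?_⟩
  obtain ⟨T, hT⟩ := eventually_atTop.1
    ((hg.eventually_le_const (show 0 < c * (ε / 2) by positivity)).and (eventually_ge_atTop a))
  have hderiv : ∀ t, T ≤ t → HasDerivAt (fun s => (V s - ε / 2) * Real.exp (c * s))
      (V' t * Real.exp (c * t) + (V t - ε / 2) * (Real.exp (c * t) * c)) t := by
    intro t ht
    have he : HasDerivAt (fun s => Real.exp (c * s)) (Real.exp (c * t) * c) t := by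
      simpa using ((hasDerivAt_id t).const_mul c).exp
    exact ((hd t (hT t ht).2).sub_const _).mul he
  have hanti : AntitoneOn (fun s => (V s - ε / 2) * Real.exp (c * s)) (Set.Ici T) := by
    refine antitoneOn_of_hasDerivWithinAt_nonpos (convex_Ici T)
      (fun t ht => (hderiv t ht).continuousAt.continuousWithinAt)
      (fun t ht => (hderiv t (interior_subset ht)).hasDerivWithinAt) fun t ht => ?_
    have htT : T ≤ t := interior_subset ht
    have h : V' t + c * (V t - ε / 2) ≤ 0 := by
      have h₁ := (hT t htT).1
      have h₂ := hle t (hT t htT).2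
      linarith
    calc _ = (V' t + c * (V t - ε / 2)) * Real.exp (c * t) := by ring
      _ ≤ 0 := mul_nonpos_of_nonpos_of_nonneg h (Real.exp_pos _).le
  have hexp : Tendsto (fun t => Real.exp (c * t)) atTop atTop :=
    Real.tendsto_exp_atTop.comp (tendsto_id.const_mul_atTop hc)
  filter_upwards [eventually_ge_atTop T, hexp.eventually_gt_atTop
    ((V T - ε / 2) * Real.exp (c * T) / (ε / 2))] with t ht hbig
  have h := hanti Set.self_mem_Ici ht ht
  rw [div_lt_iff₀ (by positivity)] at hbig
  have h' : (V t - ε / 2) * Real.exp (c * t) < ε / 2 * Real.exp (c * t) := by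
    simp only at h
    linarith
  have := lt_of_mul_lt_mul_right h' (Real.exp_pos _).le
  linarith

/-- A perturbed linear flow `x' = -A x + ξ` with `A` positive definite and vanishing input
converges to zero. -/
theorem Matrix.PosDef.tendsto_zero_of_hasDerivAt {ι : Type*} [Fintype ι]
    {A : Matrix ι ι ℝ} (hA : A.PosDef) {ξ x : ℝ → ι → ℝ} {a : ℝ}
    (hξ : Tendsto ξ atTop (nhds 0))
    (hx : ∀ t, a ≤ t → HasDerivAt x (-(A *ᵥ x t) + ξ t) t) :
    Tendsto x atTop (nhds 0) := by
  obtain ⟨c, hc, hcA⟩ := hA.exists_pos_mul_dotProduct_self_le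
  have hVnonneg : ∀ v : ι → ℝ, 0 ≤ v ⬝ᵥ v := fun v =>
    Finset.sum_nonneg fun i _ => mul_self_nonneg (v i)
  have hderiv : ∀ t, a ≤ t → HasDerivAt (fun s => x s ⬝ᵥ x s)
      (2 * (x t ⬝ᵥ (-(A *ᵥ x t) + ξ t))) t := by
    intro t ht
    have hi := hasDerivAt_pi.1 (hx t ht)
    have h := HasDerivAt.fun_sum (u := Finset.univ) fun i _ => (hi i).mul (hi i)
    refine h.congr_deriv ?_
    rw [dotProduct, Finset.mul_sum]
    exact Finset.sum_congr rfl fun i _ => by ring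
  have hle : ∀ t, a ≤ t → 2 * (x t ⬝ᵥ (-(A *ᵥ x t) + ξ t)) ≤
      -c * (x t ⬝ᵥ x t) + c⁻¹ * (ξ t ⬝ᵥ ξ t) := by
    intro t _
    have hyoung : 2 * (x t ⬝ᵥ ξ t) ≤ c * (x t ⬝ᵥ x t) + c⁻¹ * (ξ t ⬝ᵥ ξ t) := by
      simp only [dotProduct, Finset.mul_sum, ← Finset.sum_add_distrib]
      refine Finset.sum_le_sum fun i _ => ?_
      have h : 0 ≤ c⁻¹ * (c * x t i - ξ t i) ^ 2 := by positivity
      have e : c⁻¹ * (c * x t i - ξ t i) ^ 2 =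
          c * (x t i * x t i) + c⁻¹ * (ξ t i * ξ t i) - 2 * (x t i * ξ t i) := by
        field_simp
        ring
      linarith
    have h := hcA (x t)
    rw [dotProduct_add, dotProduct_neg]
    linarith
  have hg : Tendsto (fun t => c⁻¹ * (ξ t ⬝ᵥ ξ t)) atTop (nhds 0) := by
    have hcont : Continuous fun v : ι → ℝ => c⁻¹ * (v ⬝ᵥ v) := by fun_prop
    simpa [Function.comp_def] using (hcont.tendsto 0).comp hξ
  have hV := tendsto_zero_of_hasDerivAt_le_neg_mul_add hc (fun t => hVnonneg (x t)) hderiv hle hg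
  refine tendsto_pi_nhds.2 fun i => ?_
  have hsq : Tendsto (fun t => x t i ^ 2) atTop (nhds 0) :=
    squeeze_zero (fun t => sq_nonneg _) (fun t => by
      rw [sq]
      exact Finset.single_le_sum (f := fun j => x t j * x t j)
        (fun j _ => mul_self_nonneg (x t j)) (Finset.mem_univ i)) hV
  have habs := hsq.sqrt
  simp only [Real.sqrt_sq_eq_abs, Real.sqrt_zero] at habs
  exact (tendsto_zero_iff_abs_tendsto_zero _).2 habs

/-- The quadratic form of a weighted Laplacian is the Dirichlet energy. -/
theorem dotProduct_mulVec_weightedLaplacian {V : Type*} [Fintype V] {w : V → V → ℝ}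
    (hw_symm : ∀ i j, w i j = w j i) (hw_diag : ∀ i, w i i = 0) {L : Matrix V V ℝ}
    (hL_diag : ∀ i, L i i = ∑ j, w i j) (hL_off : ∀ i j, i ≠ j → L i j = - w i j)
    (x : V → ℝ) :
    x ⬝ᵥ L *ᵥ x = 1 / 2 * ∑ i, ∑ j, w i j * (x i - x j) ^ 2 := by
  classical
  have hL : ∀ i j, L i j = (if i = j then ∑ k, w i k else 0) - w i j := by
    intro i j
    split_ifs with h
    · subst h
      rw [hL_diag, hw_diag, sub_zero]
    · rw [hL_off i j h, zero_sub]
  have hleft : x ⬝ᵥ L *ᵥ x = ∑ i, ∑ j, w i j * (x i ^ 2 - x i * x j) := by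
    rw [dotProduct]
    refine Finset.sum_congr rfl fun i _ => ?_
    simp only [mulVec, dotProduct, hL, sub_mul, ite_mul, zero_mul, Finset.sum_sub_distrib,
      Finset.sum_ite_eq, Finset.mem_univ, if_true, mul_sub, Finset.sum_mul, Finset.mul_sum]
    congr 1 <;> exact Finset.sum_congr rfl fun j _ => by ring
  have hswap : ∑ i, ∑ j, w i j * (x i ^ 2 - x i * x j) =
      ∑ i, ∑ j, w i j * (x j ^ 2 - x i * x j) := by
    rw [Finset.sum_comm]
    refine Finset.sum_congr rfl fun i _ => Finset.sum_congr rfl fun j _ => ?_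
    rw [hw_symm j i, mul_comm (x j)]
  have hsum : ∑ i, ∑ j, w i j * (x i - x j) ^ 2 =
      ∑ i, ∑ j, w i j * (x i ^ 2 - x i * x j) + ∑ i, ∑ j, w i j * (x j ^ 2 - x i * x j) := by
    simp only [← Finset.sum_add_distrib]
    exact Finset.sum_congr rfl fun i _ => Finset.sum_congr rfl fun j _ => by ring
  rw [hleft, hsum, ← hswap]
  ring

/-- A nonnegative, nonzero diagonal plus a positive multiple of the weighted Laplacian of a
connected graph is positive definite. -/
theorem posDef_diagonal_add_smul_weightedLaplacian {V : Type*} [Fintype V] [DecidableEq V]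
    {w : V → V → ℝ} (hw_symm : ∀ i j, w i j = w j i) (hw_nonneg : ∀ i j, 0 ≤ w i j)
    (hw_diag : ∀ i, w i i = 0) {L : Matrix V V ℝ}
    (hL_diag : ∀ i, L i i = ∑ j, w i j) (hL_off : ∀ i j, i ≠ j → L i j = - w i j)
    {G : SimpleGraph V} (hG : ∀ i j, G.Adj i j → 0 < w i j) (hconn : G.Connected)
    {d : V → ℝ} (hd_nonneg : ∀ i, 0 ≤ d i) (hd_pos : ∃ i, 0 < d i) {κ : ℝ} (hκ : 0 < κ) :
    (diagonal d + κ • L).PosDef := by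
  refine .of_dotProduct_mulVec_pos ?_ fun x hx => ?_
  · refine IsHermitian.ext fun i j => ?_
    rcases eq_or_ne i j with rfl | h
    · simp
    · simp [diagonal_apply_ne _ h, diagonal_apply_ne _ h.symm, hL_off _ _ h, hL_off _ _ h.symm,
        hw_symm i j]
  have hdiag : x ⬝ᵥ diagonal d *ᵥ x = ∑ i, d i * x i ^ 2 := by
    simp only [dotProduct, mulVec_diagonal]
    exact Finset.sum_congr rfl fun i _ => by ring
  have hform : star x ⬝ᵥ (diagonal d + κ • L) *ᵥ x =
      ∑ i, d i * x i ^ 2 + κ * (1 / 2 * ∑ i, ∑ j, w i j * (x i - x j) ^ 2) := by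
    rw [star_trivial, add_mulVec, dotProduct_add, hdiag, smul_mulVec, dotProduct_smul,
      smul_eq_mul, dotProduct_mulVec_weightedLaplacian hw_symm hw_diag hL_diag hL_off]
  have hterm₁ : ∀ i, 0 ≤ d i * x i ^ 2 := fun i => mul_nonneg (hd_nonneg i) (sq_nonneg _)
  have hterm₂ : ∀ i j, 0 ≤ w i j * (x i - x j) ^ 2 := fun i j =>
    mul_nonneg (hw_nonneg i j) (sq_nonneg _)
  have hrow : ∀ i, 0 ≤ ∑ j, w i j * (x i - x j) ^ 2 := fun i =>
    Finset.sum_nonneg fun j _ => hterm₂ i j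
  have hsum₁ : 0 ≤ ∑ i, d i * x i ^ 2 := Finset.sum_nonneg fun i _ => hterm₁ i
  have hsum₂ : 0 ≤ ∑ i, ∑ j, w i j * (x i - x j) ^ 2 := Finset.sum_nonneg fun i _ => hrow i
  rw [hform]
  by_cases hadj : ∀ i j, G.Adj i j → x i = x j
  · have hconst : ∀ i j, x i = x j := fun i j => by
      obtain ⟨p⟩ := hconn.preconnected i j
      induction p with
      | nil => rfl
      | cons h _ ih => exact (hadj _ _ h).trans ih
    obtain ⟨i, hi⟩ := hd_pos
    have hxi : x i ≠ 0 := fun h => hx (funext fun j => (hconst j i).trans h)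
    have : 0 < ∑ i, d i * x i ^ 2 :=
      Finset.sum_pos' (fun j _ => hterm₁ j) ⟨i, Finset.mem_univ i, by positivity⟩
    positivity
  · push Not at hadj
    obtain ⟨i, j, hij, hne⟩ := hadj
    have hw := hG i j hij
    have hsub : x i - x j ≠ 0 := sub_ne_zero.2 hne
    have : 0 < ∑ i, ∑ j, w i j * (x i - x j) ^ 2 :=
      Finset.sum_pos' (fun i _ => hrow i) ⟨i, Finset.mem_univ i,
        Finset.sum_pos' (fun j _ => hterm₂ i j) ⟨j, Finset.mem_univ j, by positivity⟩⟩
    positivity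

/-- redundancy under partial loss of global positioning: if the
sensory graph is connected, `D` is diagonal with nonnegative entries at least one
of which is positive, `κ_f > 0`, and `ξ(t) → 0`, then the solution of
`x̃' = -[(D + κ_f L) ⊗ I_n] x̃ + ξ` converges to zero. -/
theorem redundancy_partial_global_positioning
    (N n : ℕ) (hN : 2 ≤ N)
    (w : Fin N → Fin N → ℝ)
    (hw_symm : ∀ i j, w i j = w j i)
    (hw_nonneg : ∀ i j, 0 ≤ w i j)
    (hw_diag : ∀ i, w i i = 0)
    (L : Matrix (Fin N) (Fin N) ℝ)
    (hL_diag : ∀ i, L i i = ∑ j, w i j)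
    (hL_off : ∀ i j, i ≠ j → L i j = - w i j)
    (G : SimpleGraph (Fin N))
    (hG : ∀ i j, G.Adj i j ↔ (i ≠ j ∧ 0 < w i j))
    (hconn : G.Connected)
    (d : Fin N → ℝ) (hd_nonneg : ∀ i, 0 ≤ d i) (hd_pos : ∃ i, 0 < d i)
    (κf : ℝ) (hκf : 0 < κf)
    (ξ : ℝ → (Fin N × Fin n → ℝ)) (hξc : Continuous ξ)
    (hξ : Tendsto ξ atTop (nhds 0))
    (xt : ℝ → (Fin N × Fin n → ℝ))
    (hxt : ∀ t : ℝ, 0 ≤ t → HasDerivAt xt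
      (-(((Matrix.diagonal d + κf • L) ⊗ₖ (1 : Matrix (Fin n) (Fin n) ℝ)).mulVec (xt t))
        + ξ t) t) :
    Tendsto xt atTop (nhds 0) := by
  have hA := (posDef_diagonal_add_smul_weightedLaplacian hw_symm hw_nonneg hw_diag hL_diag hL_off
    (fun i j h => ((hG i j).1 h).2) hconn hd_nonneg hd_pos hκf).kronecker
    (PosDef.one (n := Fin n) (R := ℝ))
  exact hA.tendsto_zero_of_hasDerivAt hξ hxt
end

section
/- (Average consensus of the Laplacian flow.) Let L ∈ ℝ^{N×N} be the weighted Laplacian of symmetric nonnegative weights whose associated graph is connected, and let y : ℝ → ℝ^N be differentiable with y'(t) = −L y(t) for all t ≥ 0. Then y(t) converges as t → ∞ to the vector ȳ 𝟙, where ȳ = (1/N) Σ_{i=1}^N y_i(0) is the average of the initial values and 𝟙 is the all-ones vector; i.e., the flow converges to the agreement set span{𝟙}. -/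
open Matrix BigOperators Filter

/-- The Laplacian matrix acts by weighted differences. -/
theorem laplacian_mulVec_apply {ι : Type*} [Fintype ι] [DecidableEq ι] {w : ι → ι → ℝ}
    (hw_diag : ∀ i, w i i = 0) {L : Matrix ι ι ℝ} (hL_diag : ∀ i, L i i = ∑ j, w i j)
    (hL_off : ∀ i j, i ≠ j → L i j = -w i j) (x : ι → ℝ) (i : ι) :
    (L *ᵥ x) i = ∑ j, w i j * (x i - x j) := by
  have hL (j : ι) : L i j = (if i = j then ∑ k, w i k else 0) - w i j := by
    by_cases h : i = j
    · subst h
      simp [hL_diag, hw_diag]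
    · simp [h, hL_off i j h]
  simp [mulVec, dotProduct, hL, sub_mul, mul_sub, Finset.sum_sub_distrib, Finset.sum_mul, ite_mul]

/-- Summation by parts for symmetric weights. -/
theorem two_mul_sum_mul_sum_weighted_sub {ι : Type*} [Fintype ι] {w : ι → ι → ℝ}
    (hw_symm : ∀ i j, w i j = w j i) (u x : ι → ℝ) :
    2 * ∑ i, u i * ∑ j, w i j * (x i - x j) =
      ∑ i, ∑ j, w i j * ((u i - u j) * (x i - x j)) := by
  have hswap : ∑ i, u i * ∑ j, w i j * (x i - x j) =
      ∑ i, ∑ j, u j * (w i j * (x j - x i)) := by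
    rw [Finset.sum_comm]
    refine Finset.sum_congr rfl fun i _ => ?_
    rw [Finset.mul_sum]
    exact Finset.sum_congr rfl fun j _ => by rw [hw_symm i j]
  rw [two_mul]
  nth_rewrite 2 [hswap]
  simp_rw [Finset.mul_sum, ← Finset.sum_add_distrib]
  exact Finset.sum_congr rfl fun i _ => Finset.sum_congr rfl fun j _ => by ring

/-- On a connected weighted graph, the difference of a function at two vertices is controlled by
its Dirichlet energy. -/
theorem SimpleGraph.Reachable.exists_sq_sub_le_energy {ι : Type*} [Fintype ι] {w : ι → ι → ℝ}
    (hw_nonneg : ∀ i j, 0 ≤ w i j) {G : SimpleGraph ι} (hG : ∀ i j, G.Adj i j → 0 < w i j)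
    {a b : ι} (hab : G.Reachable a b) :
    ∃ C : ℝ, 0 ≤ C ∧ ∀ x : ι → ℝ,
      (x a - x b) ^ 2 ≤ C * ∑ i, ∑ j, w i j * (x i - x j) ^ 2 := by
  obtain ⟨p⟩ := hab
  induction p with
  | nil => exact ⟨0, le_rfl, fun x => by simp⟩
  | @cons a b c h p ih =>
    obtain ⟨C, hC, hbound⟩ := ih
    have hw := hG a b h
    refine ⟨2 * (w a b)⁻¹ + 2 * C, by positivity, fun x => ?_⟩
    have hterm (i j : ι) : 0 ≤ w i j * (x i - x j) ^ 2 :=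
      mul_nonneg (hw_nonneg i j) (sq_nonneg _)
    have hedge : w a b * (x a - x b) ^ 2 ≤ ∑ i, ∑ j, w i j * (x i - x j) ^ 2 :=
      (Finset.single_le_sum (fun j _ => hterm a j) (Finset.mem_univ b)).trans
        (Finset.single_le_sum (f := fun i => ∑ j, w i j * (x i - x j) ^ 2)
          (fun i _ => Finset.sum_nonneg fun j _ => hterm i j) (Finset.mem_univ a))
    have hedge' := (le_inv_mul_iff₀ hw).2 hedge
    have hbc := hbound x
    nlinarith [sq_nonneg ((x a - x b) - (x b - x c))]

/-- A Poincaré inequality on connected weighted graphs. -/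
theorem SimpleGraph.Connected.exists_sum_sq_sub_le_energy {ι : Type*} [Fintype ι]
    {w : ι → ι → ℝ} (hw_nonneg : ∀ i j, 0 ≤ w i j) {G : SimpleGraph ι}
    (hG : ∀ i j, G.Adj i j → 0 < w i j) (hconn : G.Connected) :
    ∃ K : ℝ, 0 < K ∧ ∀ x : ι → ℝ,
      ∑ i, ∑ j, (x i - x j) ^ 2 ≤ K * ∑ i, ∑ j, w i j * (x i - x j) ^ 2 := by
  choose C hC hbound using fun i j : ι =>
    (hconn.preconnected i j).exists_sq_sub_le_energy hw_nonneg hG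
  have hsum : 0 ≤ ∑ i, ∑ j, C i j :=
    Finset.sum_nonneg fun i _ => Finset.sum_nonneg fun j _ => hC i j
  refine ⟨∑ i, ∑ j, C i j + 1, by positivity, fun x => ?_⟩
  have henergy : 0 ≤ ∑ i, ∑ j, w i j * (x i - x j) ^ 2 :=
    Finset.sum_nonneg fun i _ => Finset.sum_nonneg fun j _ =>
      mul_nonneg (hw_nonneg i j) (sq_nonneg _)
  calc ∑ i, ∑ j, (x i - x j) ^ 2
      ≤ ∑ i, ∑ j, C i j * ∑ k, ∑ l, w k l * (x k - x l) ^ 2 :=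
        Finset.sum_le_sum fun i _ => Finset.sum_le_sum fun j _ => hbound i j x
    _ = (∑ i, ∑ j, C i j) * ∑ k, ∑ l, w k l * (x k - x l) ^ 2 := by simp_rw [Finset.sum_mul]
    _ ≤ _ := by gcongr; linarith

/-- The sum of all squared pairwise differences in terms of deviations from the mean. -/
theorem sum_sum_sq_sub_eq_card_mul_sum_sq_sub {ι : Type*} [Fintype ι] (x : ι → ℝ) {m : ℝ}
    (hm : ∑ i, x i = Fintype.card ι * m) :
    ∑ i, ∑ j, (x i - x j) ^ 2 = 2 * Fintype.card ι * ∑ i, (x i - m) ^ 2 := by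
  have hzero : ∑ i, (x i - m) = 0 := by simp [hm]
  have hexpand (i j : ι) : (x i - x j) ^ 2 =
      (x i - m) ^ 2 - 2 * (x i - m) * (x j - m) + (x j - m) ^ 2 := by ring
  simp_rw [hexpand, Finset.sum_add_distrib, Finset.sum_sub_distrib, ← Finset.mul_sum, hzero]
  simp [← Finset.mul_sum]
  ring

/-- A nonnegative function satisfying `V' ≤ -c V` on `[0, ∞)` with `c > 0` tends to zero. -/
theorem tendsto_zero_of_hasDerivAt_le_neg_mul {V V' : ℝ → ℝ} {c : ℝ} (hc : 0 < c)
    (hnonneg : ∀ t, 0 ≤ V t) (hderiv : ∀ t, 0 ≤ t → HasDerivAt V (V' t) t)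
    (hle : ∀ t, 0 ≤ t → V' t ≤ -c * V t) : Tendsto V atTop (nhds 0) := by
  have hD (t : ℝ) (ht : 0 ≤ t) : HasDerivAt (fun s => Real.exp (c * s) * V s)
      (Real.exp (c * t) * (c * V t + V' t)) t := by
    have hexp : HasDerivAt (fun s => Real.exp (c * s)) (Real.exp (c * t) * c) t := by
      simpa using ((hasDerivAt_id t).const_mul c).exp
    exact (hexp.mul (hderiv t ht)).congr_deriv (by ring)
  have hanti : AntitoneOn (fun s => Real.exp (c * s) * V s) (Set.Ici 0) := by
    refine antitoneOn_of_hasDerivWithinAt_nonpos (convex_Ici 0)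
      (fun t ht => (hD t ht).continuousAt.continuousWithinAt)
      (fun t ht => (hD t (interior_subset ht)).hasDerivWithinAt) fun t ht => ?_
    exact mul_nonpos_of_nonneg_of_nonpos (Real.exp_pos _).le
      (by linarith [hle t (interior_subset ht)])
  have hlim : Tendsto (fun t => Real.exp (-(c * t)) * V 0) atTop (nhds 0) := by
    simpa using (Real.tendsto_exp_neg_atTop_nhds_zero.comp
      (tendsto_id.const_mul_atTop hc)).mul_const (V 0)
  refine squeeze_zero' (Eventually.of_forall hnonneg) ?_ hlim
  filter_upwards [eventually_ge_atTop 0] with t ht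
  have h := hanti (Set.mem_Ici.2 le_rfl) (Set.mem_Ici.2 ht) ht
  simp only [mul_zero, Real.exp_zero, one_mul] at h
  rw [Real.exp_neg]
  exact (le_inv_mul_iff₀ (Real.exp_pos _)).2 h

/-- average consensus of the Laplacian flow: for a connected
weighted graph with Laplacian `L`, the solution of `y' = -L y` converges to the
vector `ȳ 𝟙` whose entries all equal the average of the initial values. -/
theorem laplacian_flow_average_consensus
    (N : ℕ) (hN : 2 ≤ N)
    (w : Fin N → Fin N → ℝ)
    (hw_symm : ∀ i j, w i j = w j i)
    (hw_nonneg : ∀ i j, 0 ≤ w i j)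
    (hw_diag : ∀ i, w i i = 0)
    (L : Matrix (Fin N) (Fin N) ℝ)
    (hL_diag : ∀ i, L i i = ∑ j, w i j)
    (hL_off : ∀ i j, i ≠ j → L i j = - w i j)
    (G : SimpleGraph (Fin N))
    (hG : ∀ i j, G.Adj i j ↔ (i ≠ j ∧ 0 < w i j))
    (hconn : G.Connected)
    (y : ℝ → (Fin N → ℝ))
    (hy : ∀ t : ℝ, 0 ≤ t → HasDerivAt y (-(L.mulVec (y t))) t) :
    Tendsto y atTop (nhds (fun _ => (∑ i, y 0 i) / N)) := by
  have hcoord (t : ℝ) (ht : 0 ≤ t) (i : Fin N) :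
      HasDerivAt (fun s => y s i) (-∑ j, w i j * (y t i - y t j)) t := by
    have h := hasDerivAt_pi.1 (hy t ht) i
    rwa [Pi.neg_apply, laplacian_mulVec_apply hw_diag hL_diag hL_off] at h
  have hN0 : (0 : ℝ) < N := by exact_mod_cast (by omega : 0 < N)
  set m : ℝ := (∑ i, y 0 i) / N with hm
  have hmean (t : ℝ) (ht : 0 ≤ t) : ∑ i, y t i = N * m := by
    have hsumD (s : ℝ) (hs : 0 ≤ s) : HasDerivAt (fun s => ∑ i, y s i) 0 s := by
      refine (HasDerivAt.fun_sum fun i _ => hcoord s hs i).congr_deriv ?_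
      have h := two_mul_sum_mul_sum_weighted_sub hw_symm (fun _ => 1) (y s)
      simp only [one_mul, sub_self, zero_mul, mul_zero, Finset.sum_const_zero] at h
      rw [Finset.sum_neg_distrib]
      linarith
    have hconst := constant_of_has_deriv_right_zero (a := 0) (b := t)
      (fun s hs => (hsumD s hs.1).continuousAt.continuousWithinAt)
      (fun s hs => (hsumD s hs.1).hasDerivWithinAt) t ⟨ht, le_rfl⟩
    rw [hconst, hm]
    field_simp
  obtain ⟨K, hK, hpoincare⟩ :=
    hconn.exists_sum_sq_sub_le_energy hw_nonneg fun i j h => ((hG i j).1 h).2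
  have hV : Tendsto (fun t => ∑ i, (y t i - m) ^ 2) atTop (nhds 0) := by
    refine tendsto_zero_of_hasDerivAt_le_neg_mul (c := 2 * N / K)
      (V' := fun t => -∑ i, ∑ j, w i j * (y t i - y t j) ^ 2) (by positivity)
      (fun t => Finset.sum_nonneg fun i _ => sq_nonneg _) (fun t ht => ?_) fun t ht => ?_
    · refine (HasDerivAt.fun_sum fun i _ =>
        ((hcoord t ht i).sub_const m).fun_pow 2).congr_deriv ?_
      have h := two_mul_sum_mul_sum_weighted_sub hw_symm (fun i => y t i - m) (y t)
      simp only [sub_sub_sub_cancel_right, ← sq] at h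
      rw [← h, Finset.mul_sum, ← Finset.sum_neg_distrib]
      exact Finset.sum_congr rfl fun i _ => by push_cast; ring
    · have h := hpoincare (y t)
      rw [sum_sum_sq_sub_eq_card_mul_sum_sq_sub (m := m) (y t) (by simpa using hmean t ht),
        Fintype.card_fin, ← div_le_iff₀' hK] at h
      rw [neg_mul, neg_le_neg_iff, div_mul_eq_mul_div]
      exact h
  refine tendsto_pi_nhds.2 fun i => tendsto_sub_nhds_zero_iff.1 ?_
  have hsq : Tendsto (fun t => (y t i - m) ^ 2) atTop (nhds 0) :=
    squeeze_zero (fun t => sq_nonneg _) (fun t => Finset.single_le_sum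
      (f := fun i => (y t i - m) ^ 2) (fun j _ => sq_nonneg _) (Finset.mem_univ i)) hV
  refine (tendsto_zero_iff_abs_tendsto_zero _).2 ?_
  simpa [Function.comp_def, Real.sqrt_sq_eq_abs] using hsq.sqrt
end
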